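/- arXiv:2106.12959 — 2 statements merged into one kernel-verified Lean document; each statement's English description precedes it below -/
import Mathlib

section
/- Let X be a multiset of n points and S a multiset of m points, both contained in the closed ball B(0,Λ) ⊂ ℝ^d, let k ≥ 1, L ≥ 1, and for a center set C put Δ(C) = 5·√((Λ²·k·d/(n·m))·cost²_X(C)·L). Assume: (i) for every set C of at most k centers contained in B(0,Λ), |(1/m)·cost²_S(C) − (1/n)·cost²_X(C)| ≤ Δ(C); and (ii) OPT²_k(X) ≥ 100·(n/m)·Λ²·k·d·L. Then every set Č of k centers in B(0,Λ) with cost²_S(Č) ≤ 2·OPT²_k(S) satisfies cost²_X(Č) ≤ 8·OPT²_k(X). -/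
open scoped BigOperators Classical

/-- The `p`-objective clustering cost of the multiset `X` w.r.t. the centers `C`. -/
noncomputable def kmcost (p : ℕ) {d k : ℕ} (X : Multiset (EuclideanSpace ℝ (Fin d)))
    (C : Fin k → EuclideanSpace ℝ (Fin d)) : ℝ :=
  (X.map fun x => ⨅ i, ‖x - C i‖ ^ p).sum

/-- The optimal `p`-objective `k`-clustering cost of the multiset `X`. -/
noncomputable def kmOPT (p : ℕ) {d : ℕ} (k : ℕ) (X : Multiset (EuclideanSpace ℝ (Fin d))) : ℝ :=
  ⨅ C : Fin k → EuclideanSpace ℝ (Fin d), kmcost p X C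

/-- `Dmin C i = min_{j ≠ i} ‖C i - C j‖`. -/
noncomputable def Dmin {d k : ℕ} (C : Fin k → EuclideanSpace ℝ (Fin d)) (i : Fin k) : ℝ :=
  ⨅ j : {j : Fin k // j ≠ i}, ‖C i - C j.1‖

/-- The mean of a finite multiset of points. -/
noncomputable def mmean {d : ℕ} (S : Multiset (EuclideanSpace ℝ (Fin d))) :
    EuclideanSpace ℝ (Fin d) :=
  (S.card : ℝ)⁻¹ • S.sum

/-- The optimal `p`-objective `k`-clustering cost with centers restricted to the closed ball of
radius `Λ` around the origin. -/
noncomputable def kmOPTB (p : ℕ) {d : ℕ} (Λ : ℝ) (k : ℕ)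
    (X : Multiset (EuclideanSpace ℝ (Fin d))) : ℝ :=
  ⨅ C : Fin k → (Metric.closedBall (0 : EuclideanSpace ℝ (Fin d)) Λ),
    kmcost p X fun i => (C i : EuclideanSpace ℝ (Fin d))

lemma kmcost_nonneg' {d k : ℕ} (X : Multiset (EuclideanSpace ℝ (Fin d)))
    (C : Fin k → EuclideanSpace ℝ (Fin d)) : 0 ≤ kmcost 2 X C := by
  unfold kmcost
  apply Multiset.sum_nonneg
  intro y hy
  obtain ⟨x, _, rfl⟩ := Multiset.mem_map.1 hy
  exact Real.iInf_nonneg fun i => by positivity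

lemma kmOPTB_le' {d k : ℕ} (Λ : ℝ) (X : Multiset (EuclideanSpace ℝ (Fin d)))
    (C : Fin k → EuclideanSpace ℝ (Fin d)) (hC : ∀ i, ‖C i‖ ≤ Λ) :
    kmOPTB 2 Λ k X ≤ kmcost 2 X C := by
  unfold kmOPTB
  exact ciInf_le (f := fun C : Fin k → (Metric.closedBall (0 : EuclideanSpace ℝ (Fin d)) Λ) =>
    kmcost 2 X fun i => (C i : EuclideanSpace ℝ (Fin d)))
    ⟨0, by rintro _ ⟨C, rfl⟩; exact kmcost_nonneg' _ _⟩
    (fun i => ⟨C i, by simpa using hC i⟩)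

/-- Every `2`-approximate center set for the subsample `S` is an `8`-approximate center set
for `X`. -/
theorem stmt13 {d k : ℕ} (hk : 1 ≤ k) (Λ L : ℝ) (hΛ : 0 < Λ) (hL : 1 ≤ L)
    (X S : Multiset (EuclideanSpace ℝ (Fin d)))
    (hXcard : 0 < X.card) (hScard : 0 < S.card)
    (hXball : ∀ x ∈ X, ‖x‖ ≤ Λ) (hSball : ∀ x ∈ S, ‖x‖ ≤ Λ)
    (hconc : ∀ m : ℕ, m ≤ k → ∀ C : Fin m → EuclideanSpace ℝ (Fin d), (∀ i, ‖C i‖ ≤ Λ) →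
      |(S.card : ℝ)⁻¹ * kmcost 2 S C - (X.card : ℝ)⁻¹ * kmcost 2 X C| ≤
        5 * Real.sqrt (Λ ^ 2 * k * d / ((X.card : ℝ) * (S.card : ℝ)) * kmcost 2 X C * L))
    (hOPT : kmOPTB 2 Λ k X ≥ 100 * ((X.card : ℝ) / (S.card : ℝ)) * Λ ^ 2 * k * d * L) :
    ∀ C : Fin k → EuclideanSpace ℝ (Fin d), (∀ i, ‖C i‖ ≤ Λ) →
      kmcost 2 S C ≤ 2 * kmOPTB 2 Λ k S →
      kmcost 2 X C ≤ 8 * kmOPTB 2 Λ k X := by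
  have hn : (0:ℝ) < X.card := by exact_mod_cast hXcard
  have hm : (0:ℝ) < S.card := by exact_mod_cast hScard
  have key : ∀ C : Fin k → EuclideanSpace ℝ (Fin d), (∀ i, ‖C i‖ ≤ Λ) →
      |(S.card : ℝ)⁻¹ * kmcost 2 S C - (X.card : ℝ)⁻¹ * kmcost 2 X C| ≤
        (X.card : ℝ)⁻¹ * kmcost 2 X C / 2 := by
    intro C hC
    refine (hconc k le_rfl C hC).trans ?_
    have h0 := kmcost_nonneg' X C
    have h1 := hOPT.le.trans (kmOPTB_le' Λ X C hC)
    have h2 : Real.sqrt (Λ ^ 2 * k * d / ((X.card : ℝ) * (S.card : ℝ)) * kmcost 2 X C * L)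
        ≤ (X.card : ℝ)⁻¹ * kmcost 2 X C / 10 := by
      apply Real.sqrt_le_iff.2 ⟨by positivity, ?_⟩
      have h3 := mul_le_mul_of_nonneg_right h1
        (show 0 ≤ kmcost 2 X C * (X.card : ℝ)⁻¹ ^ 2 / 100 by positivity)
      refine (le_of_eq ?_).trans (h3.trans (le_of_eq ?_)) <;> field_simp
      all_goals norm_num
    linarith
  intro C hC hS
  have hC1 := (abs_le.1 (key C hC)).1
  have main : kmcost 2 X C / 6 ≤ kmOPTB 2 Λ k X := by
    have : Nonempty (Metric.closedBall (0 : EuclideanSpace ℝ (Fin d)) Λ) :=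
      ⟨⟨0, by simpa using hΛ.le⟩⟩
    refine le_ciInf fun C' => ?_
    have hb : ∀ i, ‖(C' i : EuclideanSpace ℝ (Fin d))‖ ≤ Λ := fun i => by
      exact mem_closedBall_zero_iff.1 (C' i).2
    have h1 := (abs_le.1 (key _ hb)).2
    have h2 := kmOPTB_le' Λ S _ hb
    have h3 := mul_le_mul_of_nonneg_left
      (hS.trans (mul_le_mul_of_nonneg_left h2 zero_le_two)) (inv_pos.2 hm).le
    refine le_of_mul_le_mul_left ?_ (inv_pos.2 hn)
    linarith
  have h0 := kmcost_nonneg' X C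
  linarith
end

section
/- Let X be a finite multiset of points in ℝ^d, k ≥ 2, and let C* = {c*₁,…,c*_k} be an optimal k-means center set for X with induced clusters X*₁,…,X*_k, where each c*_i equals the mean of X*_i. Then for every i, OPT²_{k−1}(X) ≤ OPT²_k(X) + n_i·D_i², where n_i = |X*_i| and D_i = min_{j≠i} ‖c*_i − c*_j‖. -/
open scoped BigOperators Classical

theorem aux_shift {d : ℕ} (S : Multiset (EuclideanSpace ℝ (Fin d))) (a b : EuclideanSpace ℝ (Fin d)) :
    (S.map fun x => ‖x - b‖ ^ 2).sum = (S.map fun x => ‖x - a‖ ^ 2).sum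
      + 2 * inner ℝ (S.sum - (S.card : ℝ) • a) (a - b) + (S.card : ℝ) * ‖a - b‖ ^ 2 := by
  induction S using Multiset.induction_on with
  | empty => simp
  | cons x S ih =>
    simp only [Multiset.map_cons, Multiset.sum_cons, Multiset.card_cons, ih]
    have h1 : ‖x - b‖ ^ 2 = ‖x - a‖ ^ 2 + 2 * inner ℝ (x - a) (a - b) + ‖a - b‖ ^ 2 := by
      rw [← norm_add_sq_real]; congr 2; abel
    have h2 : x + S.sum - ((S.card + 1 : ℕ) : ℝ) • a = (x - a) + (S.sum - (S.card : ℝ) • a) := by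
      push_cast; rw [add_smul, one_smul]; abel
    rw [h2, inner_add_left, h1]; push_cast; ring

theorem aux_mean {d : ℕ} (S : Multiset (EuclideanSpace ℝ (Fin d))) (hS : S ≠ 0)
    (a b : EuclideanSpace ℝ (Fin d)) (ha : a = mmean S) :
    (S.map fun x => ‖x - b‖ ^ 2).sum = (S.map fun x => ‖x - a‖ ^ 2).sum
      + (S.card : ℝ) * ‖a - b‖ ^ 2 := by
  have hc : (S.card : ℝ) ≠ 0 := by simpa using hS
  have h0 : S.sum - (S.card : ℝ) • a = 0 := by
    rw [ha, mmean, smul_smul, mul_inv_cancel₀ hc, one_smul, sub_self]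
  rw [aux_shift S a b, h0]; simp

theorem aux_sum {d : ℕ} {ι : Type} (s : Finset ι) (Y : ι → Multiset (EuclideanSpace ℝ (Fin d)))
    (f : EuclideanSpace ℝ (Fin d) → ℝ) :
    ((∑ l ∈ s, Y l).map f).sum = ∑ l ∈ s, ((Y l).map f).sum := by
  induction s using Finset.induction_on with
  | empty => simp
  | insert a s ha ih => simp [Finset.sum_insert ha, ih]

/-- Deleting one optimal center: `OPT²_{k−1}(X) ≤ OPT²_k(X) + n_i·D_i²` for every `i`. -/
theorem stmt19 {d k : ℕ} (hk : 2 ≤ k)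
    (X : Multiset (EuclideanSpace ℝ (Fin d)))
    (Cstar : Fin k → EuclideanSpace ℝ (Fin d)) (hinj : Function.Injective Cstar)
    (hopt : kmcost 2 X Cstar = kmOPT 2 k X)
    (Xc : Fin k → Multiset (EuclideanSpace ℝ (Fin d)))
    (hpart : ∑ i, Xc i = X)
    (hassign : ∀ i, ∀ x ∈ Xc i, ∀ j, ‖x - Cstar i‖ ≤ ‖x - Cstar j‖)
    (hne : ∀ i, Xc i ≠ 0)
    (hmean : ∀ i, Cstar i = mmean (Xc i)) :
    ∀ i, kmOPT 2 (k - 1) X ≤ kmOPT 2 k X + ((Xc i).card : ℝ) * Dmin Cstar i ^ 2 := by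
  intro i
  obtain ⟨m, rfl⟩ : ∃ m, k = m + 2 := ⟨k - 2, by omega⟩
  change kmOPT 2 (m + 1) X ≤ _
  haveI : Nonempty {j : Fin (m + 2) // j ≠ i} := ⟨⟨i.succAbove 0, Fin.succAbove_ne i 0⟩⟩
  obtain ⟨⟨j, hji⟩, hj⟩ := exists_eq_ciInf_of_finite (f := fun j : {j : Fin (m + 2) // j ≠ i} => ‖Cstar i - Cstar j.1‖)
  have hD : Dmin Cstar i = ‖Cstar i - Cstar j‖ := hj.symm
  have h1 : kmOPT 2 (m + 1) X ≤ kmcost 2 X (fun l => Cstar (i.succAbove l)) := by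
    refine ciInf_le ⟨0, ?_⟩ _
    rintro _ ⟨C, rfl⟩
    refine Multiset.sum_nonneg ?_
    intro y hy
    obtain ⟨x, -, rfl⟩ := Multiset.mem_map.1 hy
    exact Real.iInf_nonneg fun l => by positivity
  have hf : ∀ x, ∀ l, l ≠ i → (⨅ r, ‖x - Cstar (i.succAbove r)‖ ^ 2) ≤ ‖x - Cstar l‖ ^ 2 := by
    intro x l hl
    obtain ⟨r, rfl⟩ := Fin.exists_succAbove_eq hl
    exact ciInf_le (Set.finite_range _).bddBelow r
  have hg : ∀ l, ∀ x ∈ Xc l, ‖x - Cstar l‖ ^ 2 ≤ ⨅ r, ‖x - Cstar r‖ ^ 2 := by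
    intro l x hx
    refine le_ciInf fun r => ?_
    have := hassign l x hx r
    gcongr
  refine h1.trans ?_
  rw [← hopt, hD, ← hpart]
  unfold kmcost
  rw [aux_sum, aux_sum]
  have key : ∀ l, ((Xc l).map fun x => ⨅ r, ‖x - Cstar (i.succAbove r)‖ ^ 2).sum ≤
      ((Xc l).map fun x => ⨅ r, ‖x - Cstar r‖ ^ 2).sum +
        if l = i then ((Xc i).card : ℝ) * ‖Cstar i - Cstar j‖ ^ 2 else 0 := by
    intro l
    have hgl := Multiset.sum_map_le_sum_map _ _ (hg l)
    split_ifs with h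
    · subst h
      have := Multiset.sum_map_le_sum_map (s := Xc l) _ _ (fun x _ => hf x j hji)
      have := aux_mean (Xc l) (hne l) _ (Cstar j) (hmean l)
      linarith
    · have := Multiset.sum_map_le_sum_map (s := Xc l) _ _ (fun x _ => hf x l h)
      linarith
  refine (Finset.sum_le_sum fun l _ => key l).trans ?_
  rw [Finset.sum_add_distrib]
  simp
end
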